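/- An n-tuple (r_1,...,r_n) with entries in {0,1,...,n-1} ∪ {∞} is a type B_n bracket vector (i.e., arises from a centrally symmetric triangulation of a (2n+2)-gon) if and only if: (i) for all 1 ≤ i < j ≤ n, if r_j - (j-i) is a nonnegative integer then r_i ≤ r_j - (j-i) (where ∞ minus an integer is ∞, and anything is ≤ ∞); (ii) if ∞ > r_i ≥ i then r_{n+i-r_i} = ∞. -/

import Mathlib

/-- Condition (i) for type `B_n` bracket vectors: for `i < j` (0-based),
if `r_j - (j-i)` is a nonnegative integer then `r_i ≤ r_j - (j-i)`
(equivalently `r_i + (j-i) ≤ r_j`; when `r_j = ∞` this holds trivially,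
matching the convention that `∞` minus an integer is `∞`). -/
def condIB (n : ℕ) (r : Fin n → ℕ∞) : Prop :=
  ∀ i j : Fin n, i < j → (((j : ℕ) - (i : ℕ) : ℕ) : ℕ∞) ≤ r j →
    r i + (((j : ℕ) - (i : ℕ) : ℕ) : ℕ∞) ≤ r j

/-- Condition (ii) for type `B_n` bracket vectors: if `∞ > r_i ≥ i`
(1-based; here `i = k+1` for the 0-based index `k`) then `r_{n+i-r_i} = ∞`. -/
def condIIB (n : ℕ) (r : Fin n → ℕ∞) : Prop :=
  ∀ (k : Fin n) (t : ℕ), r k = (t : ℕ∞) → ∀ _ht : (k : ℕ) + 1 ≤ t,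
    r ⟨n + (k : ℕ) - t, by have := k.isLt; omega⟩ = ⊤

/-- Entries lie in `{0, …, n-1} ∪ {∞}`. -/
def entriesB (n : ℕ) (r : Fin n → ℕ∞) : Prop :=
  ∀ k, r k = ⊤ ∨ r k ≤ ((n - 1 : ℕ) : ℕ∞)

/-- A type `B_n` bracket vector. -/
def isBVec (n : ℕ) (r : Fin n → ℕ∞) : Prop :=
  entriesB n r ∧ condIB n r ∧ condIIB n r

/-- The half-turn rotation of the `(2n+2)`-gon: `w ↦ w + (n+1) (mod 2n+2)`. -/
def rotB (n : ℕ) (w : Fin (2 * n + 2)) : Fin (2 * n + 2) :=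
  w + ⟨n + 1, by omega⟩

/-- A type `B_n` triangulation: a triangulation of a convex `(2n+2)`-gon that
is fixed under a half-turn rotation.  The vertices are labelled clockwise
`1, …, n+1, 1̄, …, (n+1)̄`; here vertex `i` gets index `i - 1 ∈ Fin (2n+2)` and
vertex `j̄` gets index `n + j`.  A triangulation is a maximal collection of
pairwise noncrossing diagonals, each recorded as a pair `(a, b)` with
`a < b`. -/
structure TriB (n : ℕ) where
  /-- The diagonals of the triangulation. -/
  diags : Finset (Fin (2 * n + 2) × Fin (2 * n + 2))
  lt : ∀ p ∈ diags, p.1 < p.2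
  /-- Each chord is a diagonal: its endpoints are not adjacent on the polygon. -/
  isDiag : ∀ p ∈ diags, (p.1 : ℕ) + 1 < (p.2 : ℕ) ∧
    ¬((p.1 : ℕ) = 0 ∧ (p.2 : ℕ) = 2 * n + 1)
  /-- No two diagonals cross in the interior. -/
  noncross : ∀ p ∈ diags, ∀ q ∈ diags, ¬(p.1 < q.1 ∧ q.1 < p.2 ∧ p.2 < q.2)
  /-- Maximality: any diagonal crossing no diagonal of the collection belongs
  to it. -/
  maximal : ∀ c : Fin (2 * n + 2) × Fin (2 * n + 2), c.1 < c.2 →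
    ((c.1 : ℕ) + 1 < (c.2 : ℕ) ∧ ¬((c.1 : ℕ) = 0 ∧ (c.2 : ℕ) = 2 * n + 1)) →
    (∀ q ∈ diags, ¬(c.1 < q.1 ∧ q.1 < c.2 ∧ c.2 < q.2) ∧
      ¬(q.1 < c.1 ∧ c.1 < q.2 ∧ q.2 < c.2)) →
    c ∈ diags
  /-- Central symmetry: the collection is fixed under the half-turn. -/
  symm : ∀ p ∈ diags,
    (if rotB n p.1 < rotB n p.2 then (rotB n p.1, rotB n p.2)
      else (rotB n p.2, rotB n p.1)) ∈ diags

/-- The index of the vertex `i = k + 1`, for a 0-based index `k ∈ Fin n`. -/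
def vtxB (n : ℕ) (k : Fin n) : Fin (2 * n + 2) :=
  ⟨(k : ℕ), by have := k.isLt; omega⟩

/-- The index of the vertex `1̄`, from which the clockwise search starts. -/
def startB (n : ℕ) : Fin (2 * n + 2) := ⟨n + 1, by omega⟩

/-- The position of a vertex in the clockwise search order starting at `1̄`. -/
def keyB (n : ℕ) (w : Fin (2 * n + 2)) : Fin (2 * n + 2) := w - startB n

/-- The vertices joined to vertex `i = k + 1` by a chord of `T`, together with
the counterclockwise neighbour `i - 1` of `i` (the endpoint of the edge
segment used when no chord is found by the search). -/
noncomputable def nbrsB (n : ℕ) (T : TriB n) (k : Fin n) :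
    Finset (Fin (2 * n + 2)) :=
  insert (vtxB n k - ⟨1, by omega⟩)
    ((T.diags.filter fun p => p.1 = vtxB n k ∨ p.2 = vtxB n k).image
      fun p => if p.1 = vtxB n k then p.2 else p.1)

/-- The other endpoint `v_i` of `C_i(T)`: the first vertex connected to
`i = k + 1` (or the counterclockwise neighbour `i - 1`) encountered searching
clockwise from `1̄`. -/
noncomputable def endB (n : ℕ) (T : TriB n) (k : Fin n) : Fin (2 * n + 2) :=
  ((nbrsB n T k).image (keyB n)).min'
      ((Finset.insert_nonempty _ _).image _) + startB n

/-- The bracket vector of a type `B_n` triangulation: `r_i` is the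
counterclockwise distance from `i - 1` to the endpoint `v_i` of `C_i(T)` if
that distance is at most `n - 1`, and `∞` otherwise. -/
noncomputable def brB (n : ℕ) (T : TriB n) (k : Fin n) : ℕ∞ :=
  if ((vtxB n k - ⟨1, by omega⟩ - endB n T k : Fin (2 * n + 2)) : ℕ) ≤ n - 1
  then (((vtxB n k - ⟨1, by omega⟩ - endB n T k : Fin (2 * n + 2)) : ℕ) : ℕ∞)
  else ⊤

/-- The chord between `a < b` determined by a left-reach function `f` on the integers: `b` reaches
at least as far as `a`, and nothing strictly between them reaches beyond `a`. -/
def ReachChord (f : ℤ → ℤ) (a b : ℤ) : Prop :=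
  a < b ∧ f b ≤ a ∧ ∀ k, a < k → k < b → a ≤ f k

/-- A left-reach function of period `N`, encoding a centrally symmetric triangulation of a
`2N`-gon: the vertex `z` is joined to `f z`, these chords do not cross, and some vertex is the
end of a diameter. -/
structure IsReach (N : ℤ) (f : ℤ → ℤ) : Prop where
  periodic : ∀ z m, f (z + m * N) = f z + m * N
  lt_self : ∀ z, f z < z
  ge_sub : ∀ z, z - N ≤ f z
  nested : ∀ i j, i < j → f j < i → f j ≤ f i
  diameter : ∃ c, f c = c - N

namespace ReachChord

variable {f : ℤ → ℤ} {a b a' b' : ℤ}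

theorem not_cross (h : ReachChord f a b) (h' : ReachChord f a' b')
    (h₁ : a < a') (h₂ : a' < b) (h₃ : b < b') : False := by
  have := h.2.1
  have := h'.2.2 b h₂ h₃
  omega

end ReachChord

namespace IsReach

variable {N : ℤ} {f : ℤ → ℤ} {a b : ℤ}

theorem reachChord_self (hf : IsReach N f) (z : ℤ) : ReachChord f (f z) z :=
  ⟨hf.lt_self z, le_rfl, fun k h₁ h₂ => hf.nested k z h₂ h₁⟩

theorem sub_le (hf : IsReach N f) (h : ReachChord f a b) : b - a ≤ N := by
  have := hf.ge_sub b
  have := h.2.1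
  omega

theorem reachChord_shift (hf : IsReach N f) (m : ℤ) (h : ReachChord f a b) :
    ReachChord f (a + m * N) (b + m * N) := by
  obtain ⟨h₁, h₂, h₃⟩ := h
  refine ⟨by omega, ?_, fun k hk hk' => ?_⟩
  · rw [hf.periodic]; omega
  · have := h₃ (k - m * N) (by omega) (by omega)
    have := hf.periodic (k - m * N) m
    rw [sub_add_cancel] at this
    omega

/-- A chord of length at most `N` crossing no chord of `f` is a chord of `f`. -/
theorem reachChord_of_not_cross (hf : IsReach N f) (hab : a < b) (hN : b - a ≤ N)
    (h : ∀ a' b', ReachChord f a' b' → ¬(a' < a ∧ a < b' ∧ b' < b) ∧ ¬(a < a' ∧ a' < b ∧ b < b')) :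
    ReachChord f a b := by
  have hk : ∀ k, a < k → k < b → a ≤ f k := by
    intro k h₁ h₂
    by_contra hlt
    exact (h _ _ (hf.reachChord_self k)).1 ⟨by omega, h₁, h₂⟩
  refine ⟨hab, ?_, hk⟩
  by_contra! hx
  obtain ⟨c, hc⟩ := hf.diameter
  have hNpos : 0 < N := by omega
  have hxb := hf.lt_self b
  -- the diameter whose right end is the first one after `f b`
  obtain ⟨b₀, hb₀, hb₁, hb₂⟩ : ∃ b₀, f b₀ = b₀ - N ∧ b₀ - N ≤ f b ∧ f b < b₀ := by
    have h₁ := Int.emod_nonneg (f b - c) hNpos.ne'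
    have h₂ := Int.emod_lt_of_pos (f b - c) hNpos
    have h₃ := Int.emod_add_mul_ediv (f b - c) N
    refine ⟨c + ((f b - c) / N + 1) * N, ?_, ?_, ?_⟩
    · rw [hf.periodic]; omega
    · linarith
    · linarith
  have hbb₀ : b < b₀ := by
    rcases lt_trichotomy b₀ b with hlt | heq | hgt
    · have := hf.nested b₀ b hlt hb₂
      omega
    · subst heq
      omega
    · exact hgt
  obtain ⟨b', ⟨hb', hfb'⟩, hleast⟩ := Int.exists_least_of_bdd
    (P := fun z => b < z ∧ f z ≤ f b) ⟨b, fun z hz => hz.1.le⟩ ⟨b₀, hbb₀, by omega⟩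
  refine (h (f b) b' ⟨by omega, hfb', fun k h₁ h₂ => ?_⟩).2 ⟨hx, hxb, hb'⟩
  rcases lt_trichotomy k b with hlt | heq | hgt
  · exact hf.nested k b hlt h₁
  · rw [heq]
  · by_contra hlt
    have := hleast k ⟨hgt, by omega⟩
    omega

end IsReach

theorem Fin.val_sub_eq_ite {m : ℕ} (a b : Fin m) :
    ((a - b : Fin m) : ℕ) = if (b : ℕ) ≤ a then (a : ℕ) - b else m + a - b := by
  split_ifs with h
  · exact Fin.sub_val_of_le h
  · exact Fin.coe_sub_iff_lt.2 (not_le.1 h)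

theorem val_rotB (n : ℕ) (w : Fin (2 * n + 2)) :
    (rotB n w : ℕ) = if (w : ℕ) < n + 1 then (w : ℕ) + (n + 1) else (w : ℕ) - (n + 1) := by
  have := w.isLt
  unfold rotB
  rw [Fin.val_add_eq_ite]
  dsimp only
  split_ifs <;> omega

theorem val_keyB (n : ℕ) (w : Fin (2 * n + 2)) :
    (keyB n w : ℕ) = if (w : ℕ) < n + 1 then (w : ℕ) + (n + 1) else (w : ℕ) - (n + 1) := by
  have := w.isLt
  unfold keyB startB
  rw [Fin.val_sub_eq_ite]
  dsimp only
  split_ifs <;> omega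

theorem val_add_startB (n : ℕ) (w : Fin (2 * n + 2)) :
    ((w + startB n : Fin (2 * n + 2)) : ℕ) =
      if (w : ℕ) < n + 1 then (w : ℕ) + (n + 1) else (w : ℕ) - (n + 1) :=
  val_rotB n w

theorem val_vtxB_sub_one (n : ℕ) (k : Fin n) :
    ((vtxB n k - ⟨1, by omega⟩ : Fin (2 * n + 2)) : ℕ) =
      if (k : ℕ) = 0 then 2 * n + 1 else (k : ℕ) - 1 := by
  have := k.isLt
  unfold vtxB
  rw [Fin.val_sub_eq_ite]
  dsimp only
  split_ifs <;> omega

/-- `(x, y)` is a diagonal of the triangulation, with integer endpoints. -/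
def TriB.Mem {n : ℕ} (T : TriB n) (x y : ℤ) : Prop :=
  ∃ p ∈ T.diags, ((p.1 : ℕ) : ℤ) = x ∧ ((p.2 : ℕ) : ℤ) = y

/-- The vertex `k` is joined by a diagonal to the vertex congruent to `a` modulo `2n+2`, for
`-(n+1) ≤ a < k`. -/
def TriB.Joined {n : ℕ} (T : TriB n) (a k : ℤ) : Prop :=
  (0 ≤ a ∧ T.Mem a k) ∨ (a < 0 ∧ T.Mem k (a + 2 * (n + 1)))

/-- `a` represents the endpoint of `C_k(T)`. -/
structure TriB.IsEnd {n : ℕ} (T : TriB n) (k a : ℤ) : Prop where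
  ge : -(n + 1 : ℤ) ≤ a
  lt : a < k
  joined : a = k - 1 ∨ T.Joined a k
  le : ∀ a', -(n + 1 : ℤ) ≤ a' → a' < k → T.Joined a' k → a ≤ a'

/-- A joined vertex has its position in the search order determined by its lift `a`. -/
theorem TriB.exists_mem_nbrsB_of_joined {n : ℕ} (T : TriB n) (k : Fin n) {a : ℤ}
    (ha : -(n + 1 : ℤ) ≤ a) (hak : a < k) (h : T.Joined a k) :
    ∃ w ∈ nbrsB n T k, ((keyB n w : ℕ) : ℤ) = a + (n + 1) := by
  have hk := k.isLt
  rcases h with ⟨h₀, p, hp, h₁, h₂⟩ | ⟨h₀, p, hp, h₁, h₂⟩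
  · refine ⟨p.1, Finset.mem_insert_of_mem (Finset.mem_image.2 ⟨p, Finset.mem_filter.2
      ⟨hp, Or.inr ?_⟩, if_neg ?_⟩), ?_⟩
    · ext; simp only [vtxB]; omega
    · intro h; have := congrArg Fin.val h; simp only [vtxB] at this; omega
    · rw [val_keyB]; split_ifs <;> omega
  · have hp1 : p.1 = vtxB n k := by ext; simp only [vtxB]; omega
    refine ⟨p.2, Finset.mem_insert_of_mem (Finset.mem_image.2 ⟨p, Finset.mem_filter.2
      ⟨hp, Or.inl hp1⟩, if_pos hp1⟩), ?_⟩
    rw [val_keyB]; split_ifs <;> omega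

theorem TriB.joined_of_mem_nbrsB {n : ℕ} (T : TriB n) (k : Fin n) {w : Fin (2 * n + 2)}
    (hw : w ∈ nbrsB n T k) {a : ℤ} (ha : ((keyB n w : ℕ) : ℤ) = a + (n + 1)) (hak : a < k) :
    a = k - 1 ∨ T.Joined a k := by
  have hk := k.isLt
  have hwlt := w.isLt
  rw [val_keyB] at ha
  rcases Finset.mem_insert.1 hw with rfl | hw
  · left
    rw [val_vtxB_sub_one] at ha
    split_ifs at ha <;> omega
  · right
    obtain ⟨p, hp, rfl⟩ := Finset.mem_image.1 hw
    obtain ⟨hp, hor⟩ := Finset.mem_filter.1 hp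
    have hlt := T.lt p hp
    rw [Fin.lt_def] at hlt
    by_cases h₁ : p.1 = vtxB n k
    · simp only [if_pos h₁] at ha hwlt
      have h₁' : (p.1 : ℕ) = k := congrArg Fin.val h₁
      exact Or.inr ⟨by split_ifs at ha <;> omega, p, hp, by omega, by split_ifs at ha <;> omega⟩
    · have h₂' : (p.2 : ℕ) = k := congrArg Fin.val (hor.resolve_left h₁)
      simp only [if_neg h₁] at ha hwlt
      exact Or.inl ⟨by split_ifs at ha <;> omega, p, hp, by split_ifs at ha <;> omega, by omega⟩

/-- The bracket vector in terms of the endpoint of `C_k(T)`. -/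
theorem TriB.exists_isEnd {n : ℕ} (T : TriB n) (k : Fin n) :
    ∃ a : ℤ, T.IsEnd k a ∧
      brB n T k = if (k : ℤ) - 1 - a ≤ n - 1 then (((k : ℤ) - 1 - a).toNat : ℕ∞) else ⊤ := by
  have hk := k.isLt
  have hne : ((nbrsB n T k).image (keyB n)).Nonempty := (Finset.insert_nonempty _ _).image _
  set m := ((nbrsB n T k).image (keyB n)).min' hne
  obtain ⟨w, hw, hwm⟩ := Finset.mem_image.1 (Finset.min'_mem _ hne)
  have hle : ∀ w ∈ nbrsB n T k, (m : ℕ) ≤ keyB n w := fun w hw =>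
    Fin.le_def.1 (Finset.min'_le _ _ (Finset.mem_image_of_mem (keyB n) hw))
  have hmk : (m : ℤ) < k + (n + 1) := by
    have := hle _ (Finset.mem_insert_self _ _)
    rw [val_keyB, val_vtxB_sub_one] at this
    split_ifs at this <;> omega
  refine ⟨(m : ℕ) - (n + 1), ⟨by omega, by omega, ?_, ?_⟩, ?_⟩
  · exact T.joined_of_mem_nbrsB k hw (by rw [hwm]; ring) (by omega)
  · intro a' h₁ h₂ h₃
    obtain ⟨w', hw', ha'⟩ := T.exists_mem_nbrsB_of_joined k h₁ h₂ h₃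
    have := hle w' hw'
    omega
  · have hv : ((vtxB n k - ⟨1, by omega⟩ - endB n T k : Fin (2 * n + 2)) : ℕ) =
        (k : ℕ) + n - m := by
      have hend : (endB n T k : ℕ) = if (m : ℕ) < n + 1 then (m : ℕ) + (n + 1)
          else (m : ℕ) - (n + 1) := by
        exact val_add_startB n m
      have := m.isLt
      rw [Fin.val_sub_eq_ite, val_vtxB_sub_one, hend]
      split_ifs <;> omega
    have hz : ((k : ℕ) : ℤ) - 1 - ((m : ℕ) - (n + 1)) = ((k + n - m : ℕ) : ℤ) := by omega
    unfold brB
    rw [hv, hz, Int.toNat_natCast]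
    congr 1
    rw [eq_iff_iff]
    omega

theorem TriB.IsEnd.unique {n : ℕ} {T : TriB n} {k a b : ℤ} (ha : T.IsEnd k a)
    (hb : T.IsEnd k b) : a = b := by
  have h₁ : a ≤ b := by
    rcases hb.joined with h | h
    · have := ha.lt; omega
    · exact ha.le b hb.ge hb.lt h
  have h₂ : b ≤ a := by
    rcases ha.joined with h | h
    · have := hb.lt; omega
    · exact hb.le a ha.ge ha.lt h
  omega

namespace TriB

variable {n : ℕ} {T : TriB n} {x y x' y' : ℤ}

theorem Mem.bounds (h : T.Mem x y) :
    0 ≤ x ∧ x + 1 < y ∧ y < 2 * (n + 1) ∧ ¬(x = 0 ∧ y = 2 * n + 1) := by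
  obtain ⟨p, hp, rfl, rfl⟩ := h
  have := T.isDiag p hp
  omega

theorem Mem.not_cross (h : T.Mem x y) (h' : T.Mem x' y') : ¬(x < x' ∧ x' < y ∧ y < y') := by
  obtain ⟨p, hp, rfl, rfl⟩ := h
  obtain ⟨q, hq, rfl, rfl⟩ := h'
  have := T.noncross p hp q hq
  simp only [Fin.lt_def] at this
  omega

/-- The half-turn exchanges the two lifts of a diagonal separated by the middle. -/
theorem Mem.rot (h : T.Mem x y) (hx : x < n + 1) (hy : n + 1 ≤ y) :
    T.Mem (y - (n + 1)) (x + (n + 1)) := by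
  obtain ⟨p, hp, rfl, rfl⟩ := h
  have h₁ := val_rotB n p.1
  have h₂ := val_rotB n p.2
  rw [if_pos (by omega)] at h₁
  rw [if_neg (by omega)] at h₂
  have := T.symm p hp
  rw [if_neg (by rw [Fin.lt_def]; omega)] at this
  exact ⟨_, this, by simp only; omega, by simp only; omega⟩

/-- Condition (i), in terms of endpoints. -/
theorem IsEnd.nested {i j a b : ℤ} (ha : T.IsEnd i a) (hb : T.IsEnd j b)
    (hij : i < j) (hj : j < n) (hbi : b < i) : b ≤ a := by
  by_contra! hlt
  have hge := ha.ge
  have hJa : T.Joined a i := ha.joined.resolve_left (by omega)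
  have hJb : T.Joined b j := hb.joined.resolve_left (by omega)
  rcases hJa with ⟨h₁, h₂⟩ | ⟨h₁, h₂⟩ <;> rcases hJb with ⟨h₃, h₄⟩ | ⟨h₃, h₄⟩
  · exact h₂.not_cross h₄ ⟨hlt, hbi, hij⟩
  · omega
  · exact h₄.not_cross h₂ ⟨hbi, hij, by omega⟩
  · exact h₂.not_cross h₄ ⟨hij, by omega, by omega⟩

/-- Condition (ii), in terms of endpoints. -/
theorem IsEnd.le_of_neg {k a b : ℤ} (ha : T.IsEnd k a) (hk : 0 ≤ k) (hkn : k < n) (hneg : a < -1)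
    (hlen : k - a ≤ n) (hb : T.IsEnd (a + (n + 1)) b) : b ≤ a := by
  obtain ⟨h₁, h₂⟩ | ⟨h₁, h₂⟩ := ha.joined.resolve_left (by omega)
  · omega
  · refine (hb.le (k - (n + 1)) (by omega) (by omega) (Or.inr ⟨by omega, ?_⟩)).trans (by omega)
    have := h₂.rot (by omega) (by omega)
    convert this using 1 <;> ring

theorem condIB_brB (T : TriB n) : condIB n (brB n T) := by
  intro i j hij hle
  obtain ⟨a, ha, hia⟩ := T.exists_isEnd i
  obtain ⟨b, hb, hjb⟩ := T.exists_isEnd j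
  rw [Fin.lt_def] at hij
  have hj := j.isLt
  rw [hjb] at hle ⊢
  split_ifs at hle ⊢ with h
  · rw [Nat.cast_le] at hle
    have := ha.nested hb (by omega) (by omega) (by omega)
    rw [hia, if_pos (by omega), ← Nat.cast_add, Nat.cast_le]
    have := ha.lt
    omega
  · exact le_top

theorem condIIB_brB (T : TriB n) : condIIB n (brB n T) := by
  intro k t hkt ht
  obtain ⟨a, ha, hka⟩ := T.exists_isEnd k
  obtain ⟨b, hb, hjb⟩ := T.exists_isEnd ⟨n + (k : ℕ) - t, by have := k.isLt; omega⟩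
  rw [hka] at hkt
  have hk := k.isLt
  split_ifs at hkt with h
  · rw [Nat.cast_inj] at hkt
    have hidx : ((n + (k : ℕ) - t : ℕ) : ℤ) = a + (n + 1) := by omega
    rw [hjb]
    simp only [hidx] at hb ⊢
    have := ha.le_of_neg (by omega) (by omega) (by omega) (by omega) hb
    rw [if_neg (by omega)]
  · exact absurd hkt (ENat.top_ne_natCast t)

end TriB

namespace IsReach

variable {n : ℕ} {f : ℤ → ℤ}

/-- The diagonals of the `(2n+2)`-gon encoded by `f`. -/
def IsDiag (n : ℕ) (f : ℤ → ℤ) (x y : ℤ) : Prop :=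
  (x + 1 < y ∧ ¬(x = 0 ∧ y = 2 * n + 1)) ∧
    (ReachChord f x y ∨ ReachChord f (y - 2 * (n + 1)) x)

theorem reachChord_shift' (hf : IsReach (n + 1) f) {a b c d : ℤ} (m : ℤ) (h : ReachChord f a b)
    (hc : c = a + m * (n + 1)) (hd : d = b + m * (n + 1)) : ReachChord f c d := by
  subst hc hd
  exact hf.reachChord_shift m h

theorem isDiag_not_cross (hf : IsReach (n + 1) f) {x y x' y' : ℤ} (hx : 0 ≤ x)
    (hy : y' < 2 * (n + 1)) (h : IsDiag n f x y) (h' : IsDiag n f x' y') :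
    ¬(x < x' ∧ x' < y ∧ y < y') := by
  rintro ⟨h₁, h₂, h₃⟩
  rcases h.2 with h | h <;> rcases h'.2 with h' | h'
  · exact h.not_cross h' h₁ h₂ h₃
  · exact h'.not_cross h (by omega) h₁ h₂
  · have := hf.reachChord_shift' (c := y) (d := x + 2 * (n + 1)) 2 h (by ring) (by ring)
    exact h'.not_cross this h₂ h₃ (by omega)
  · exact h.not_cross h' (by omega) (by omega) h₁

theorem isDiag_of_not_cross (hf : IsReach (n + 1) f) {x y : ℤ} (hx : 0 ≤ x) (hxy : x + 1 < y)
    (hy : y < 2 * (n + 1)) (hne : ¬(x = 0 ∧ y = 2 * n + 1))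
    (h : ∀ x' y' : ℤ, 0 ≤ x' → y' < 2 * (n + 1) → IsDiag n f x' y' →
      ¬(x < x' ∧ x' < y ∧ y < y') ∧ ¬(x' < x ∧ x < y' ∧ y' < y)) :
    IsDiag n f x y := by
  refine ⟨⟨hxy, hne⟩, ?_⟩
  by_cases hlen : y - x ≤ n + 1
  · left
    refine hf.reachChord_of_not_cross (by omega) hlen fun a b hab => ⟨?_, ?_⟩
    · rintro ⟨h₁, h₂, h₃⟩
      have := hf.sub_le hab
      by_cases ha : 0 ≤ a
      · exact (h a b ha (by omega) ⟨by omega, Or.inl hab⟩).2 ⟨h₁, h₂, h₃⟩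
      · refine (h b (a + 2 * (n + 1)) (by omega) (by omega) ⟨by omega, Or.inr ?_⟩).1
          ⟨h₂, h₃, by omega⟩
        rwa [add_sub_cancel_right]
    · rintro ⟨h₁, h₂, h₃⟩
      have := hf.sub_le hab
      by_cases hb : b < 2 * (n + 1)
      · exact (h a b (by omega) hb ⟨by omega, Or.inl hab⟩).1 ⟨h₁, h₂, h₃⟩
      · exact (h (b - 2 * (n + 1)) a (by omega) (by omega) ⟨by omega, Or.inr
          (hf.reachChord_shift' (-2) hab (by ring) (by ring))⟩).2 ⟨by omega, h₁, h₂⟩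
  · right
    refine hf.reachChord_of_not_cross (by omega) (by omega) fun a b hab => ⟨?_, ?_⟩
    · rintro ⟨h₁, h₂, h₃⟩
      have := hf.sub_le hab
      by_cases hb : 0 ≤ b
      · refine (h b (a + 2 * (n + 1)) hb (by omega) ⟨by omega, Or.inr ?_⟩).2
          ⟨h₃, by omega, by omega⟩
        rwa [add_sub_cancel_right]
      · exact (h (a + 2 * (n + 1)) (b + 2 * (n + 1)) (by omega) (by omega) ⟨by omega, Or.inl
          (hf.reachChord_shift' 2 hab (by ring) (by ring))⟩).1 ⟨by omega, by omega, by omega⟩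
    · rintro ⟨h₁, h₂, h₃⟩
      have := hf.sub_le hab
      by_cases ha : 0 ≤ a
      · exact (h a b ha (by omega) ⟨by omega, Or.inl hab⟩).2 ⟨h₂, h₃, by omega⟩
      · refine (h b (a + 2 * (n + 1)) (by omega) (by omega) ⟨by omega, Or.inr ?_⟩).1
          ⟨h₃, by omega, by omega⟩
        rwa [add_sub_cancel_right]

theorem isDiag_rot (hf : IsReach (n + 1) f) {x y : ℤ} (hx : 0 ≤ x) (hy : y < 2 * (n + 1))
    (h : IsDiag n f x y) :
    IsDiag n f (y - (n + 1)) (x + (n + 1)) := by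
  obtain ⟨h₁, h₂ | h₂⟩ := h
  · have := hf.sub_le h₂
    exact ⟨by omega, Or.inr (hf.reachChord_shift' (-1) h₂ (by ring) (by ring))⟩
  · have := hf.sub_le h₂
    have := h₂.1
    exact ⟨by omega, Or.inl (hf.reachChord_shift' 1 h₂ (by ring) (by ring))⟩

theorem isDiag_add (hf : IsReach (n + 1) f) {x y : ℤ} (hx : 0 ≤ x)
    (h : IsDiag n f x y) : IsDiag n f (x + (n + 1)) (y + (n + 1)) := by
  obtain ⟨h₁, h₂ | h₂⟩ := h
  · exact ⟨by omega, Or.inl (hf.reachChord_shift' 1 h₂ (by ring) (by ring))⟩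
  · exact ⟨by omega, Or.inr (hf.reachChord_shift' 1 h₂ (by ring) (by ring))⟩

theorem isDiag_sub (hf : IsReach (n + 1) f) {x y : ℤ} (hy : y < 2 * (n + 1))
    (h : IsDiag n f x y) : IsDiag n f (x - (n + 1)) (y - (n + 1)) := by
  obtain ⟨h₁, h₂ | h₂⟩ := h
  · exact ⟨by omega, Or.inl (hf.reachChord_shift' (-1) h₂ (by ring) (by ring))⟩
  · exact ⟨by omega, Or.inr (hf.reachChord_shift' (-1) h₂ (by ring) (by ring))⟩

open Classical in
/-- The triangulation encoded by a left-reach function. -/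
noncomputable def triB (hf : IsReach (n + 1) f) : TriB n where
  diags := Finset.univ.filter fun p => IsDiag n f (p.1 : ℕ) (p.2 : ℕ)
  lt p hp := by
    have := (Finset.mem_filter.1 hp).2.1
    rw [Fin.lt_def]
    omega
  isDiag p hp := by
    have := (Finset.mem_filter.1 hp).2.1
    omega
  noncross p hp q hq := by
    have hlt := q.2.isLt
    have := hf.isDiag_not_cross (by omega) (by omega) (Finset.mem_filter.1 hp).2
      (Finset.mem_filter.1 hq).2
    simp only [Fin.lt_def]
    omega
  maximal c _ hd h := by
    have hlt := c.2.isLt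
    refine Finset.mem_filter.2 ⟨Finset.mem_univ _, hf.isDiag_of_not_cross (by omega) (by omega)
      (by omega) (by omega) fun x y hx hy hxy => ?_⟩
    have hxy1 := hxy.1.1
    lift x to ℕ using hx
    lift y to ℕ using by omega
    have := h (⟨x, by omega⟩, ⟨y, by omega⟩) (Finset.mem_filter.2 ⟨Finset.mem_univ _, hxy⟩)
    simp only [Fin.lt_def] at this
    omega
  symm p hp := by
    have hp := (Finset.mem_filter.1 hp).2
    have hlt := hp.1.1
    have h1 := p.1.isLt
    have h2 := p.2.isLt
    refine Finset.mem_filter.2 ⟨Finset.mem_univ _, ?_⟩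
    have h₁ := val_rotB n p.1
    have h₂ := val_rotB n p.2
    by_cases hx : (p.1 : ℕ) < n + 1
    · rw [if_pos hx] at h₁
      by_cases hy : (p.2 : ℕ) < n + 1
      · rw [if_pos hy] at h₂
        rw [if_pos (by rw [Fin.lt_def]; omega)]
        have := hf.isDiag_add (by omega) hp
        convert this using 1 <;> simp only [h₁, h₂] <;> push_cast <;> rfl
      · rw [if_neg hy] at h₂
        rw [if_neg (by rw [Fin.lt_def]; omega)]
        have := hf.isDiag_rot (by omega) (by omega) hp
        convert this using 1 <;> simp only [h₁, h₂] <;> omega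
    · rw [if_neg hx] at h₁
      rw [if_neg (by omega)] at h₂
      rw [if_pos (by rw [Fin.lt_def]; omega)]
      have := hf.isDiag_sub (by omega) hp
      convert this using 1 <;> simp only [h₁, h₂] <;> omega

open Classical in
theorem mem_triB (hf : IsReach (n + 1) f) {x y : ℤ} (hx : 0 ≤ x) (hy : y < 2 * (n + 1))
    (h : IsDiag n f x y) : hf.triB.Mem x y := by
  have := h.1.1
  lift x to ℕ using hx
  lift y to ℕ using by omega
  exact ⟨(⟨x, by omega⟩, ⟨y, by omega⟩), Finset.mem_filter.2 ⟨Finset.mem_univ _, h⟩, rfl, rfl⟩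

open Classical in
theorem isDiag_of_mem_triB (hf : IsReach (n + 1) f) {x y : ℤ} (h : hf.triB.Mem x y) :
    IsDiag n f x y := by
  obtain ⟨p, hp, rfl, rfl⟩ := h
  exact (Finset.mem_filter.1 hp).2

theorem brB_triB_of_forall (hf : IsReach (n + 1) f) (k : Fin n) (hlen : (k : ℤ) - n ≤ f k)
    (h : ∀ b : ℤ, 0 ≤ b → b ≤ k → ¬ReachChord f (k - (n + 1)) b) :
    brB n hf.triB k = (((k : ℤ) - 1 - f k).toNat : ℕ∞) := by
  have hk := k.isLt
  obtain ⟨a, ha, hak⟩ := hf.triB.exists_isEnd k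
  have hlt := hf.lt_self k
  have hself := hf.reachChord_self k
  have hend : hf.triB.IsEnd k (f k) := by
    refine ⟨by omega, hlt, ?_, ?_⟩
    · by_cases hf1 : f k = k - 1
      · exact Or.inl hf1
      · right
        by_cases h0 : 0 ≤ f k
        · exact Or.inl ⟨h0, hf.mem_triB h0 (by omega) ⟨by omega, Or.inl hself⟩⟩
        · refine Or.inr ⟨by omega, hf.mem_triB (by omega) (by omega) ⟨by omega, Or.inr ?_⟩⟩
          rwa [add_sub_cancel_right]
    · rintro a' h₁ h₂ (⟨h₃, h₄⟩ | ⟨h₃, h₄⟩)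
      · rcases (hf.isDiag_of_mem_triB h₄).2 with h₅ | h₅
        · exact h₅.2.1
        · have := hf.sub_le h₅
          omega
      · rcases (hf.isDiag_of_mem_triB h₄).2 with h₅ | h₅
        · have := hf.sub_le h₅
          exact absurd (hf.reachChord_shift' (-1) h₅ (by ring) (by ring))
            (h (a' + (n + 1)) (by omega) (by omega))
        · rw [add_sub_cancel_right] at h₅
          exact h₅.2.1
  rw [hak, ha.unique hend, if_pos (by omega)]

theorem brB_triB_of_exists (hf : IsReach (n + 1) f) (k : Fin n)
    (h : ∃ b : ℤ, 0 ≤ b ∧ b ≤ k ∧ ReachChord f (k - (n + 1)) b) :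
    brB n hf.triB k = ⊤ := by
  have hk := k.isLt
  obtain ⟨a, ha, hak⟩ := hf.triB.exists_isEnd k
  obtain ⟨b, hb, hbk, hc⟩ := h
  have := ha.le (b - (n + 1)) (by omega) (by omega) (Or.inr ⟨by omega,
    hf.mem_triB (by omega) (by omega)
      ⟨by omega, Or.inl (hf.reachChord_shift' 1 hc (by ring) (by ring))⟩⟩)
  rw [hak, if_neg (by omega)]

end IsReach

/-- A left-reach function may be prescribed on one period ending at the end of a diameter. -/
theorem exists_isReach_eqOn {N c : ℤ} (hN : 0 < N) (F : ℤ → ℤ)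
    (hlt : ∀ z, c - N < z → z ≤ c → F z < z) (hge : ∀ z, c - N < z → z ≤ c → c - N ≤ F z)
    (hc : F c = c - N)
    (hnest : ∀ i j, c - N < i → i < j → j ≤ c → F j < i → F j ≤ F i) :
    ∃ f, IsReach N f ∧ ∀ z, c - N < z → z ≤ c → f z = F z := by
  have hdecomp : ∀ z, ∃ m w, z = w + m * N ∧ c - N < w ∧ w ≤ c := fun z => by
    have h₁ := Int.emod_nonneg (z - c - 1) hN.ne'
    have h₂ := Int.emod_lt_of_pos (z - c - 1) hN
    have h₃ := Int.emod_add_mul_ediv (z - c - 1) N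
    exact ⟨(z - c - 1) / N + 1, (z - c - 1) % N + c - N + 1, by linarith, by omega, by omega⟩
  obtain ⟨f, hf⟩ : ∃ f : ℤ → ℤ, ∀ w m, c - N < w → w ≤ c → f (w + m * N) = F w + m * N := by
    refine ⟨fun z => F ((z - c - 1) % N + c - N + 1) + (z - ((z - c - 1) % N + c - N + 1)),
      fun w m h₁ h₂ => ?_⟩
    have h : (w + m * N - c - 1) % N = w - c - 1 + N := by
      rw [show w + m * N - c - 1 = w - c - 1 + N + (m - 1) * N by ring,
        Int.add_mul_emod_self_right]
      exact Int.emod_eq_of_lt (by omega) (by omega)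
    simp only [h]
    rw [show w - c - 1 + N + c - N + 1 = w by ring]
    ring
  have hfF : ∀ z, c - N < z → z ≤ c → f z = F z := fun z h₁ h₂ => by
    simpa using hf z 0 h₁ h₂
  refine ⟨f, ⟨fun z m => ?_, fun z => ?_, fun z => ?_, fun i j hij hlt' => ?_, c, ?_⟩, hfF⟩
  · obtain ⟨q, w, rfl, h₁, h₂⟩ := hdecomp z
    rw [show w + q * N + m * N = w + (q + m) * N by ring, hf w _ h₁ h₂, hf w _ h₁ h₂]
    ring
  · obtain ⟨q, w, rfl, h₁, h₂⟩ := hdecomp z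
    rw [hf w _ h₁ h₂]
    have := hlt w h₁ h₂
    omega
  · obtain ⟨q, w, rfl, h₁, h₂⟩ := hdecomp z
    rw [hf w _ h₁ h₂]
    have := hge w h₁ h₂
    omega
  · obtain ⟨q, w, rfl, h₁, h₂⟩ := hdecomp j
    rw [hf w _ h₁ h₂] at hlt' ⊢
    have := hge w h₁ h₂
    have := hnest (i - q * N) w (by omega) (by omega) h₂ (by omega)
    have := hf (i - q * N) q (by omega) (by omega)
    rw [sub_add_cancel] at this
    omega
  · rw [hfF c (by omega) le_rfl, hc]

/-- Completing partial data to a left-reach function: `J` marks the positions of the period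
ending at `c` where the reach is not prescribed, `h` prescribes it elsewhere, and each marked
position is made to reach the previous marked one. -/
theorem exists_isReach_of_partial {N c : ℤ} (hc₀ : 0 ≤ c) (hcN : c < N) (J : ℤ → Prop) (h : ℤ → ℤ)
    (hJc : J (c - N)) (hJ₁ : J (-1)) (hJ₀ : ∀ z, 0 ≤ z → z < c → ¬J z)
    (hlt : ∀ z, h z < z)
    (hneg : ∀ i j, c - N ≤ i → i < j → j < 0 → ¬J j → h j < i → ¬J i ∧ h j ≤ h i)
    (hpos : ∀ i j, 0 ≤ i → i < j → j < c → h j < i → h j ≤ h i)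
    (hback : ∀ k, 0 ≤ k → k < c → h k < 0 → c - N ≤ h k ∧ J (h k)) :
    ∃ f, IsReach N f ∧ f c = c - N ∧ (∀ z, c - N < z → z < c → c - N ≤ f z) ∧
      (∀ z, c - N < z → z < c → ¬J z → f z = h z) ∧
      (∀ z, c - N ≤ z → z < -1 → J z → ∃ b, 0 ≤ b ∧ b ≤ c ∧ ReachChord f z b) ∧
      ∀ z, c - N < z → z < -1 → ¬J z → ∀ b, 0 ≤ b → b ≤ c → ¬ReachChord f z b := by
  classical
  have hprev : ∀ z, ∃ p, c - N < z → c - N ≤ p ∧ p < z ∧ J p ∧ ∀ i, p < i → i < z → ¬J i := by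
    intro z
    by_cases hz : c - N < z
    · obtain ⟨p, ⟨h₁, h₂⟩, h₃⟩ := Int.exists_greatest_of_bdd (P := fun i => i < z ∧ J i)
        ⟨z, fun i hi => hi.1.le⟩ ⟨c - N, hz, hJc⟩
      refine ⟨p, fun _ => ⟨h₃ _ ⟨hz, hJc⟩, h₁, h₂, fun i hi hiz hJi => ?_⟩⟩
      have := h₃ i ⟨hiz, hJi⟩
      omega
    · exact ⟨0, fun hz' => absurd hz' hz⟩
  choose p hp using hprev
  obtain ⟨F, hFc, hFJ, hFh⟩ : ∃ F : ℤ → ℤ, F c = c - N ∧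
      (∀ z, z < c → J z → F z = p z) ∧ ∀ z, z < c → ¬J z → F z = h z :=
    ⟨fun z => if z = c then c - N else if J z then p z else h z, if_pos rfl,
      fun z hz hJ => by simp [hz.ne, hJ], fun z hz hJ => by simp [hz.ne, hJ]⟩
  have hnegJ : ∀ z, z < c → J z → z < 0 := fun z hz hJ => by
    by_contra hz'
    exact hJ₀ z (by omega) hz hJ
  have hFlt : ∀ z, c - N < z → z ≤ c → F z < z := by
    intro z h₁ h₂
    rcases h₂.eq_or_lt with rfl | h₂
    · omega
    · by_cases hJ : J z
      · rw [hFJ z h₂ hJ]; exact (hp z h₁).2.1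
      · rw [hFh z h₂ hJ]; exact hlt z
  have hmark : ∀ i z, c - N ≤ i → i < z → z < 0 → J i → i ≤ F z := by
    intro i z h₁ h₂ h₃ hJi
    by_contra! hFi
    by_cases hJ : J z
    · rw [hFJ z (by omega) hJ] at hFi
      exact (hp z (by omega)).2.2.2 i hFi h₂ hJi
    · rw [hFh z (by omega) hJ] at hFi
      exact (hneg i z h₁ h₂ h₃ hJ hFi).1 hJi
  have hFge : ∀ z, c - N < z → z ≤ c → c - N ≤ F z := by
    intro z h₁ h₂
    rcases h₂.eq_or_lt with rfl | h₂
    · omega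
    · by_cases hz : z < 0
      · exact hmark _ z le_rfl h₁ hz hJc
      · rw [hFh z h₂ (hJ₀ z (by omega) h₂)]
        by_cases hh : h z < 0
        · exact (hback z (by omega) h₂ hh).1
        · omega
  have hFnest : ∀ i j, c - N < i → i < j → j ≤ c → F j < i → F j ≤ F i := by
    intro i j h₁ h₂ h₃ h₄
    rcases h₃.eq_or_lt with rfl | h₃
    · rw [hFc]; exact hFge i h₁ (by omega)
    · by_cases hJ : J j
      · have hj := hnegJ j h₃ hJ
        rw [hFJ j h₃ hJ] at h₄ ⊢
        have := hp j (by omega)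
        exact hmark _ i this.1 h₄ (by omega) this.2.2.1
      · rw [hFh j h₃ hJ] at h₄ ⊢
        by_cases hj : j < 0
        · have := hneg i j h₁.le h₂ hj hJ h₄
          rw [hFh i (by omega) this.1]
          exact this.2
        · by_cases hi : i < 0
          · have := hback j (by omega) h₃ (by omega)
            exact hmark _ i this.1 h₄ hi this.2
          · rw [hFh i (by omega) (hJ₀ i (by omega) (by omega))]
            exact hpos i j (by omega) h₂ h₃ h₄
  obtain ⟨f, hf, hfF⟩ := exists_isReach_eqOn (by omega) F hFlt hFge hFc hFnest
  have hfc : f c = c - N := by rw [hfF c (by omega) le_rfl, hFc]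
  refine ⟨f, hf, hfc, fun z h₁ h₂ => ?_, fun z h₁ h₂ hJ => ?_, fun z h₁ h₂ hJ => ?_,
    fun z h₁ h₂ hJ b h₃ h₄ hb => ?_⟩
  · rw [hfF z h₁ h₂.le]; exact hFge z h₁ h₂.le
  · rw [hfF z h₁ h₂.le, hFh z h₂ hJ]
  · obtain ⟨b, ⟨hb₀, hbz⟩, hleast⟩ := Int.exists_least_of_bdd
      (P := fun b => 0 ≤ b ∧ f b ≤ z) ⟨0, fun b hb => hb.1⟩ ⟨c, hc₀, by omega⟩
    have hbc : b ≤ c := hleast c ⟨hc₀, by omega⟩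
    refine ⟨b, hb₀, hbc, by omega, hbz, fun i hi hib => ?_⟩
    by_cases hi₀ : i < 0
    · rw [hfF i (by omega) (by omega)]
      exact hmark z i h₁ hi hi₀ hJ
    · by_contra! hfi
      have := hleast i ⟨by omega, hfi.le⟩
      omega
  · obtain ⟨q, ⟨hzq, hJq⟩, hleast⟩ := Int.exists_least_of_bdd
      (P := fun i => z < i ∧ J i) ⟨z, fun i hi => hi.1.le⟩ ⟨-1, h₂, hJ₁⟩
    have hq₁ : q ≤ -1 := hleast _ ⟨h₂, hJ₁⟩
    have hzf := hb.2.2 q hzq (by omega)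
    rw [hfF q (by omega) (by omega), hFJ q (by omega) hJq] at hzf
    obtain ⟨-, hpq, hJp, -⟩ := hp q (by omega)
    rcases hzf.eq_or_lt with heq | hlt'
    · exact hJ (heq ▸ hJp)
    · have := hleast _ ⟨hlt', hJp⟩
      omega

/-- The tuple `r` as a function on the integers, with value `⊤` outside its index range. -/
noncomputable def extB (n : ℕ) (r : Fin n → ℕ∞) (z : ℤ) : ℕ∞ :=
  if h : 0 ≤ z ∧ z < n then r ⟨z.toNat, by omega⟩ else ⊤

section extB

variable {n : ℕ} {r : Fin n → ℕ∞}

theorem extB_natCast (k : Fin n) : extB n r ((k : ℕ) : ℤ) = r k := by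
  have := k.isLt
  rw [extB, dif_pos ⟨by omega, by omega⟩]
  rfl

theorem exists_of_extB_ne_top {z : ℤ} (hz : extB n r z ≠ ⊤) :
    ∃ k : Fin n, ((k : ℕ) : ℤ) = z ∧ r k = ((extB n r z).toNat : ℕ∞) := by
  by_cases h : 0 ≤ z ∧ z < n
  · refine ⟨⟨z.toNat, by omega⟩, Int.toNat_of_nonneg h.1, ?_⟩
    rw [ENat.natCast_toNat hz, extB, dif_pos h]
  · exact absurd (dif_neg h) hz

theorem toNat_extB_le (hr : entriesB n r) {z : ℤ} (hz : extB n r z ≠ ⊤) :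
    (extB n r z).toNat ≤ n - 1 := by
  obtain ⟨k, -, hk⟩ := exists_of_extB_ne_top hz
  have := hr k
  rw [hk, Nat.cast_le] at this
  exact this.resolve_left (ENat.natCast_ne_top _)

theorem extB_nested (hr : condIB n r) {i j : ℤ} (hi : 0 ≤ i) (hij : i < j)
    (hj : extB n r j ≠ ⊤) (hle : j - i ≤ (extB n r j).toNat) :
    extB n r i ≠ ⊤ ∧ (extB n r i).toNat + (j - i) ≤ (extB n r j).toNat := by
  obtain ⟨k, hk, hkr⟩ := exists_of_extB_ne_top hj
  have hklt := k.isLt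
  lift i to ℕ using hi
  have := hr ⟨i, by omega⟩ k (by rw [Fin.lt_def]; simp only; omega)
    (by rw [hkr, Nat.cast_le]; simp only; omega)
  rw [hkr] at this
  have hi' := extB_natCast (r := r) (⟨i, by omega⟩ : Fin n)
  simp only at hi'
  rw [← hi'] at this
  have hne : extB n r i ≠ ⊤ := fun htop => by
    rw [htop, top_add, top_le_iff] at this
    exact ENat.natCast_ne_top _ this
  refine ⟨hne, ?_⟩
  rw [← ENat.natCast_toNat hne, ← Nat.cast_add, Nat.cast_le] at this
  simp only at this
  omega

theorem extB_eq_top_of_lt (he : entriesB n r) (hr : condIIB n r) {k : ℤ} (hk : extB n r k ≠ ⊤)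
    (hlt : k + 1 ≤ (extB n r k).toNat) : extB n r (n + k - (extB n r k).toNat) = ⊤ := by
  have hle := toNat_extB_le he hk
  obtain ⟨i, rfl, hir⟩ := exists_of_extB_ne_top hk
  have hilt := i.isLt
  rw [← hr i _ hir (by omega), ← extB_natCast (r := r)]
  congr 1
  simp only
  omega

end extB

theorem exists_triB_of_cond {n : ℕ} {r : Fin n → ℕ∞} (hr : entriesB n r) (h₁ : condIB n r)
    (h₂ : condIIB n r) : ∃ T : TriB n, ∀ k : Fin n, r k = brB n T k := by
  have htop : extB n r n = ⊤ := dif_neg (by omega)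
  obtain ⟨c, ⟨hc₀, hc⟩, hcleast⟩ := Int.exists_least_of_bdd
    (P := fun z => 0 ≤ z ∧ extB n r z = ⊤) ⟨0, fun z hz => hz.1⟩ ⟨n, by omega, htop⟩
  have hcn : c ≤ n := hcleast n ⟨by omega, htop⟩
  have hbelow : ∀ z, 0 ≤ z → z < c → extB n r z ≠ ⊤ := fun z hz hzc htop => by
    have := hcleast z ⟨hz, htop⟩
    omega
  obtain ⟨u, hu₁, hu₂⟩ : ∃ u : ℤ → ℤ, (∀ z, z < 0 → u z = z + (n + 1)) ∧
      ∀ z, 0 ≤ z → u z = z :=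
    ⟨fun z => if z < 0 then z + (n + 1) else z, fun z hz => if_pos hz,
      fun z hz => if_neg (not_lt.2 hz)⟩
  obtain ⟨f, hf, hfc, hfge, hfh, hfJ, hfJ'⟩ := exists_isReach_of_partial (N := n + 1) hc₀
    (by omega) (fun z => extB n r (u z) = ⊤) (fun z => z - 1 - (extB n r (u z)).toNat)
    (by rw [hu₁ _ (by omega), sub_add_cancel]; exact hc)
    (by rw [hu₁ _ (by omega)]; simpa using htop)
    (fun z hz hzc => by rw [hu₂ z hz]; exact hbelow z hz hzc)
    (fun z => by omega)
    (fun i j hi hij hj hJ hlt => by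
      rw [hu₁ j hj] at hJ hlt ⊢
      rw [hu₁ i (by omega)]
      have := extB_nested h₁ (i := i + (n + 1)) (by omega) (by omega) hJ (by omega)
      exact ⟨this.1, by omega⟩)
    (fun i j hi hij hj hlt => by
      rw [hu₂ j (by omega)] at hlt ⊢
      rw [hu₂ i hi]
      have := extB_nested h₁ hi hij (hbelow j (by omega) hj) (by omega)
      omega)
    (fun k hk hkc hlt => by
      have hne := hbelow k hk hkc
      have hle := toNat_extB_le hr hne
      rw [hu₂ k hk] at hlt ⊢
      rw [hu₁ _ hlt]
      by_cases hk1 : k + 1 ≤ (extB n r k).toNat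
      · have htop' := extB_eq_top_of_lt hr h₂ hne hk1
        have := hcleast _ ⟨by omega, htop'⟩
        refine ⟨by omega, ?_⟩
        rw [← htop']
        congr 1
        ring
      · refine ⟨by omega, ?_⟩
        rw [← htop]
        congr 1
        omega)
  refine ⟨hf.triB, fun k => ?_⟩
  have hk := k.isLt
  rw [← extB_natCast (r := r)]
  have hu : u ((k : ℤ) - (n + 1)) = k := by rw [hu₁ _ (by omega)]; ring
  by_cases hkc : (k : ℤ) < c
  · have hne := hbelow k (by omega) hkc
    have hle := toNat_extB_le hr hne
    have hfk : f k = k - 1 - (extB n r k).toNat := by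
      have := hfh k (by omega) hkc
      rw [hu₂ _ (by omega)] at this
      exact this hne
    rw [hf.brB_triB_of_forall k (by omega) fun b hb₀ hbk hb => ?_, hfk]
    · conv_lhs => rw [← ENat.natCast_toNat hne]
      congr 1
      omega
    · have := hfge b (by omega) (by omega)
      have := hb.2.1
      omega
  · by_cases htop' : extB n r (k : ℤ) = ⊤
    · obtain ⟨b, hb₀, hbc, hb⟩ := hfJ ((k : ℤ) - (n + 1)) (by omega) (by omega) (by rw [hu, htop'])
      rw [htop', hf.brB_triB_of_exists k ⟨b, hb₀, by omega, hb⟩]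
    · have hkc' : c < k := by
        refine lt_of_le_of_ne (not_lt.1 hkc) ?_
        rintro rfl
        exact htop' hc
      have hle := toNat_extB_le hr htop'
      have hfk : f k = k - 1 - (extB n r k).toNat := by
        have := hfh (k - (n + 1)) (by omega) (by omega)
        rw [hu] at this
        have := this htop'
        have := hf.periodic k (-1)
        rw [show (k : ℤ) + -1 * (n + 1) = k - (n + 1) by ring] at this
        omega
      rw [hf.brB_triB_of_forall k (by omega) fun b hb₀ hbk hb => ?_, hfk]
      · conv_lhs => rw [← ENat.natCast_toNat htop']
        congr 1
        omega
      · by_cases hbc : b ≤ c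
        · exact hfJ' _ (by omega) (by omega) (by rwa [hu]) b hb₀ hbc hb
        · have := hb.2.2 c (by omega) (by omega)
          omega

/-- An `n`-tuple with entries in `{0,…,n-1} ∪ {∞}` is the bracket vector of a
centrally symmetric triangulation of a `(2n+2)`-gon iff it satisfies
conditions (i) and (ii). -/
theorem bracket_vector_characterization_B (n : ℕ) (r : Fin n → ℕ∞)
    (hr : entriesB n r) :
    (∃ T : TriB n, ∀ k : Fin n, r k = brB n T k) ↔
      (condIB n r ∧ condIIB n r) := by
  constructor
  · rintro ⟨T, hT⟩
    rw [show r = brB n T from funext hT]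
    exact ⟨T.condIB_brB, T.condIIB_brB⟩
  · rintro ⟨h₁, h₂⟩
    exact exists_triB_of_cond hr h₁ h₂
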